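/- arXiv:2601.12229 — 7 statements merged into one kernel-verified Lean document; each statement's English description precedes it below -/
import Mathlib

section
/- Let g, k, h, h₁ > 0, r > 0 and γ₁ ∈ ℝ satisfy tanh(kh₁)/(kh₁) < γ₁²h₁/(g + γ₁²h₁). Then the constant term of the dispersion quartic P₄ is strictly negative, and P₄ has at least two real roots of opposite sign: there exist real numbers c₁ < 0 < c₂ with P₄(c₁) = 0 and P₄(c₂) = 0. -/
/-- The dispersion quartic `P₄(c; γ₁)` for coupled surface and internal linear
waves over a flat bed, with constant vorticity `γ₁` in the upper layer. -/
noncomputable def P₄ (g k h h₁ r γ₁ c : ℝ) : ℝ :=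
  (1 + (1 + r) / (Real.tanh (k * h) * Real.tanh (k * h₁))) * c ^ 4
    - γ₁ * h₁ * (2 + ((1 + r) / Real.tanh (k * h)) *
        (2 / Real.tanh (k * h₁) - 1 / (k * h₁))) * c ^ 3
    - ((g * (1 + r) / k) * (1 / Real.tanh (k * h₁) + 1 / Real.tanh (k * h))
        + (γ₁ * h₁) ^ 2 * ((1 / (k * h₁) + (1 + r) / Real.tanh (k * h)) *
            (1 / (k * h₁) - 1 / Real.tanh (k * h₁)) - 1)) * c ^ 2
    - (γ₁ * h₁ / k) * (γ₁ ^ 2 * h₁ * (1 / Real.tanh (k * h₁) - 1 / (k * h₁))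
        + g * ((r - 1) / (k * h₁) - 2 * r / Real.tanh (k * h₁))) * c
    - (r * g / k) * ((γ₁ * h₁) ^ 2 * (1 / Real.tanh (k * h₁) - 1 / (k * h₁)) - g / k)

lemma exists_pos_root_quartic {a b d e f : ℝ} (ha : 0 < a) (hf : f < 0) :
    ∃ c : ℝ, 0 < c ∧ a * c ^ 4 + b * c ^ 3 + d * c ^ 2 + e * c + f = 0 := by
  set M : ℝ := 1 + (|b| + |d| + |e| + |f|) / a with hM
  have hM1 : 1 ≤ M := by
    have : 0 ≤ (|b| + |d| + |e| + |f|) / a := by positivity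
    linarith
  have haM : |b| + |d| + |e| + |f| ≤ a * M := by
    have : a * M = a + (|b| + |d| + |e| + |f|) := by rw [hM]; field_simp
    linarith
  have h0 : 0 ≤ M := by linarith
  have h1 : M ≤ M ^ 3 := le_self_pow₀ hM1 (by norm_num)
  have h2 : M ^ 2 ≤ M ^ 3 := pow_le_pow_right₀ hM1 (by norm_num)
  have h3 : 1 ≤ M ^ 3 := one_le_pow₀ hM1
  have hb : -(|b| * M ^ 3) ≤ b * M ^ 3 := by
    nlinarith [neg_abs_le b]
  have hd : -(|d| * M ^ 3) ≤ d * M ^ 2 := by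
    nlinarith [neg_abs_le d, abs_nonneg d, sq_nonneg M]
  have he : -(|e| * M ^ 3) ≤ e * M := by
    nlinarith [neg_abs_le e, abs_nonneg e]
  have hf' : -(|f| * M ^ 3) ≤ f := by
    nlinarith [neg_abs_le f, abs_nonneg f]
  have hpos : 0 ≤ a * M ^ 4 + b * M ^ 3 + d * M ^ 2 + e * M + f := by
    nlinarith [mul_le_mul_of_nonneg_right haM (by positivity : 0 ≤ M ^ 3)]
  have hcont : ContinuousOn
      (fun c : ℝ => a * c ^ 4 + b * c ^ 3 + d * c ^ 2 + e * c + f) (Set.Icc 0 M) := by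
    fun_prop
  obtain ⟨c, ⟨hc, -⟩, hroot⟩ := intermediate_value_Icc h0 hcont
    (show (0 : ℝ) ∈ Set.Icc _ _ from ⟨by simpa using hf.le, hpos⟩)
  refine ⟨c, lt_of_le_of_ne hc ?_, hroot⟩
  rintro rfl
  simp at hroot
  exact hf.ne hroot

lemma exists_neg_root_quartic {a b d e f : ℝ} (ha : 0 < a) (hf : f < 0) :
    ∃ c : ℝ, c < 0 ∧ a * c ^ 4 + b * c ^ 3 + d * c ^ 2 + e * c + f = 0 := by
  obtain ⟨c, hc, h⟩ := exists_pos_root_quartic (b := -b) (d := d) (e := -e) ha hf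
  exact ⟨-c, neg_lt_zero.2 hc, by linear_combination h⟩

/-- if `tanh(kh₁)/(kh₁) < γ₁²h₁/(g + γ₁²h₁)` then the constant
term of the dispersion quartic is strictly negative and `P₄` has two real
roots of opposite sign. -/
theorem stmt2 (g k h h₁ r γ₁ : ℝ)
    (hg : 0 < g) (hk : 0 < k) (hh : 0 < h) (hh₁ : 0 < h₁) (hr : 0 < r)
    (hcond : Real.tanh (k * h₁) / (k * h₁) < γ₁ ^ 2 * h₁ / (g + γ₁ ^ 2 * h₁)) :
    (-(r * g / k) *
        ((γ₁ * h₁) ^ 2 * (1 / Real.tanh (k * h₁) - 1 / (k * h₁)) - g / k) < 0) ∧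
    ∃ c₁ c₂ : ℝ, c₁ < 0 ∧ 0 < c₂ ∧
      P₄ g k h h₁ r γ₁ c₁ = 0 ∧ P₄ g k h h₁ r γ₁ c₂ = 0 := by
  have tanh_pos : ∀ {x : ℝ}, 0 < x → 0 < Real.tanh x := fun hx => by
    rw [Real.tanh_eq_sinh_div_cosh]
    exact div_pos (Real.sinh_pos_iff.2 hx) (Real.cosh_pos _)
  have hT := tanh_pos (mul_pos hk hh)
  have hT₁ := tanh_pos (mul_pos hk hh₁)
  have hconst : -(r * g / k) *
      ((γ₁ * h₁) ^ 2 * (1 / Real.tanh (k * h₁) - 1 / (k * h₁)) - g / k) < 0 := by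
    rw [div_lt_div_iff₀ (by positivity) (by positivity)] at hcond
    refine mul_neg_of_neg_of_pos (neg_lt_zero.2 (by positivity)) ?_
    have key : (γ₁ * h₁) ^ 2 * (1 / Real.tanh (k * h₁) - 1 / (k * h₁)) - g / k
        = (γ₁ ^ 2 * h₁ * (k * h₁) - Real.tanh (k * h₁) * (g + γ₁ ^ 2 * h₁))
          / (k * Real.tanh (k * h₁)) := by
      generalize Real.tanh (k * h₁) = T at hT₁
      field_simp
      ring
    rw [key]
    exact div_pos (sub_pos.2 hcond) (by positivity)
  have hlead : 0 < 1 + (1 + r) / (Real.tanh (k * h) * Real.tanh (k * h₁)) := by positivity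
  obtain ⟨b, d, e, hP⟩ : ∃ b d e : ℝ, ∀ c, P₄ g k h h₁ r γ₁ c =
      (1 + (1 + r) / (Real.tanh (k * h) * Real.tanh (k * h₁))) * c ^ 4 + b * c ^ 3 + d * c ^ 2
        + e * c + -(r * g / k) *
          ((γ₁ * h₁) ^ 2 * (1 / Real.tanh (k * h₁) - 1 / (k * h₁)) - g / k) := by
    refine ⟨-(γ₁ * h₁ * (2 + ((1 + r) / Real.tanh (k * h)) *
        (2 / Real.tanh (k * h₁) - 1 / (k * h₁)))),
      -((g * (1 + r) / k) * (1 / Real.tanh (k * h₁) + 1 / Real.tanh (k * h))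
        + (γ₁ * h₁) ^ 2 * ((1 / (k * h₁) + (1 + r) / Real.tanh (k * h)) *
            (1 / (k * h₁) - 1 / Real.tanh (k * h₁)) - 1)),
      -((γ₁ * h₁ / k) * (γ₁ ^ 2 * h₁ * (1 / Real.tanh (k * h₁) - 1 / (k * h₁))
        + g * ((r - 1) / (k * h₁) - 2 * r / Real.tanh (k * h₁)))), fun c => ?_⟩
    simp only [P₄, sub_eq_add_neg, neg_mul]
  obtain ⟨c₁, hc₁, hroot₁⟩ := exists_neg_root_quartic (b := b) (d := d) (e := e) hlead hconst
  obtain ⟨c₂, hc₂, hroot₂⟩ := exists_pos_root_quartic (b := b) (d := d) (e := e) hlead hconst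
  exact ⟨hconst, c₁, c₂, hc₁, hc₂, (hP c₁).trans hroot₁, (hP c₂).trans hroot₂⟩
end

section
/- Let γ₁ > 0, k > 0, 𝔠 > 0 and 0 < M₁ < k𝔠. Then there exists exactly one real number Ȳ with M₁·e^{−Ȳ} − k𝔠 − γ₁·Ȳ = 0, and this Ȳ satisfies Ȳ < 0. Moreover, F(X,Y) := M₁·cos X·e^{−Y} − k𝔠 − γ₁·Y satisfies F(X,Y) < 0 for every X and every Y > Ȳ, and the Hessian of H₁(X,Y) := −M₁·cos X·e^{−Y} − (γ₁/2)·Y² − k𝔠·Y at (0,Ȳ) is diagonal with diagonal entries M₁·e^{−Ȳ} > 0 and −M₁·e^{−Ȳ} − γ₁ < 0; in particular (0,Ȳ) is a nondegenerate saddle point of H₁. -/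
/-- The Hamiltonian of the upper-layer travelling-wave system in the case
`A = 1`: `H₁(X,Y) = −M₁ cos X e^{−Y} − (γ₁/2)Y² − ν Y` with `ν = k𝔠`. -/
noncomputable def H₁ (M₁ ν γ₁ X Y : ℝ) : ℝ :=
  -M₁ * Real.cos X * Real.exp (-Y) - (γ₁ / 2) * Y ^ 2 - ν * Y

/-- The horizontal velocity on the line `X = 0`, `Y ↦ M e^{−Y} − ν − γ Y`, is strictly decreasing. -/
theorem strictAnti_crest_profile {M γ : ℝ} (hM : 0 < M) (hγ : 0 < γ) (ν : ℝ) :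
    StrictAnti fun Y : ℝ => M * Real.exp (-Y) - ν - γ * Y := by
  intro a b hab
  have h₁ : M * Real.exp (-b) < M * Real.exp (-a) :=
    mul_lt_mul_of_pos_left (Real.exp_lt_exp.mpr (neg_lt_neg hab)) hM
  have h₂ : γ * a < γ * b := mul_lt_mul_of_pos_left hab hγ
  change M * Real.exp (-b) - ν - γ * b < M * Real.exp (-a) - ν - γ * a
  linarith

theorem exists_crest_profile_eq_zero {M γ ν : ℝ} (hM : 0 < M) (hγ : 0 < γ) (hν : M < ν) :
    ∃ Y : ℝ, M * Real.exp (-Y) - ν - γ * Y = 0 := by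
  have hcont : ContinuousOn (fun Y : ℝ => M * Real.exp (-Y) - ν - γ * Y)
      (Set.Icc (-(ν / γ)) 0) := by fun_prop
  have hle : -(ν / γ) ≤ 0 := neg_nonpos.mpr (div_pos (hM.trans hν) hγ).le
  obtain ⟨Y, -, hY⟩ := intermediate_value_Icc' hle hcont (show (0 : ℝ) ∈ Set.Icc _ _ by
    constructor
    · simpa using hν.le
    · have h : γ * -(ν / γ) = -ν := by field_simp
      have := mul_pos hM (Real.exp_pos (- -(ν / γ)))
      change 0 ≤ M * Real.exp (- -(ν / γ)) - ν - γ * -(ν / γ)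
      linarith)
  exact ⟨Y, hY⟩

theorem hasDerivAt_H₁_fst (M ν γ X Y : ℝ) :
    HasDerivAt (fun X => H₁ M ν γ X Y) (M * Real.sin X * Real.exp (-Y)) X := by
  unfold H₁
  refine (((((Real.hasDerivAt_cos X).const_mul (-M)).mul_const (Real.exp (-Y))).sub_const
    ((γ / 2) * Y ^ 2)).sub_const (ν * Y)).congr_deriv ?_
  ring

theorem hasDerivAt_H₁_snd (M ν γ X Y : ℝ) :
    HasDerivAt (fun Y => H₁ M ν γ X Y) (M * Real.cos X * Real.exp (-Y) - ν - γ * Y) Y := by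
  unfold H₁
  refine (((((hasDerivAt_id Y).neg.exp).const_mul (-M * Real.cos X)).sub
    (((hasDerivAt_id Y).pow 2).const_mul (γ / 2))).sub
    ((hasDerivAt_id Y).const_mul ν)).congr_deriv ?_
  simp
  ring

theorem not_isLocalMax_H₁ {M : ℝ} (hM : 0 < M) (ν γ Y : ℝ) :
    ¬ IsLocalMax (fun p : ℝ × ℝ => H₁ M ν γ p.1 p.2) (0, Y) := by
  intro h
  have hc : Filter.Tendsto (fun X : ℝ => (X, Y)) (nhdsWithin 0 (Set.Ioi 0)) (nhds (0, Y)) :=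
    (Continuous.tendsto (by fun_prop) 0).mono_left nhdsWithin_le_nhds
  obtain ⟨X, hX, hX0, hXπ⟩ :=
    ((hc.eventually h).and (Ioo_mem_nhdsGT Real.pi_pos)).exists
  have hcos : Real.cos X < 1 := by
    simpa using Real.cos_lt_cos_of_nonneg_of_le_pi le_rfl hXπ.le hX0
  have := mul_lt_mul_of_pos_left hcos (mul_pos hM (Real.exp_pos (-Y)))
  simp only [H₁, Real.cos_zero] at hX
  linarith

theorem not_isLocalMin_H₁ {M γ ν Y : ℝ} (hM : 0 < M) (hγ : 0 < γ)
    (hY : M * Real.exp (-Y) - ν - γ * Y = 0) :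
    ¬ IsLocalMin (fun p : ℝ × ℝ => H₁ M ν γ p.1 p.2) (0, Y) := by
  intro h
  have hanti : StrictAntiOn (fun Z => H₁ M ν γ 0 Z) (Set.Ici Y) := by
    refine strictAntiOn_of_deriv_neg (convex_Ici Y)
      (fun Z _ => (hasDerivAt_H₁_snd M ν γ 0 Z).continuousAt.continuousWithinAt) ?_
    intro Z hZ
    rw [interior_Ici] at hZ
    rw [(hasDerivAt_H₁_snd M ν γ 0 Z).deriv, Real.cos_zero, mul_one, ← hY]
    exact strictAnti_crest_profile hM hγ ν hZ
  have hc : Filter.Tendsto (fun Z : ℝ => ((0 : ℝ), Z)) (nhdsWithin Y (Set.Ioi Y))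
      (nhds (0, Y)) :=
    (Continuous.tendsto (by fun_prop) Y).mono_left nhdsWithin_le_nhds
  obtain ⟨Z, hZ, hYZ⟩ := ((hc.eventually h).and self_mem_nhdsWithin).exists
  exact (hanti Set.self_mem_Ici (le_of_lt hYZ) hYZ).not_ge hZ

/-- for `γ₁ > 0`, `k > 0`, `𝔠 > 0` and `0 < M₁ < k𝔠` there is a
unique `Yb` with `M₁e^{−Yb} − k𝔠 − γ₁Yb = 0`; it is negative, `F < 0` above it,
and `(0,Yb)` is a nondegenerate saddle of `H₁` with diagonal Hessian entries
`M₁e^{−Yb} > 0` and `−M₁e^{−Yb} − γ₁ < 0`. -/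
theorem stmt4 (γ₁ k 𝔠 M₁ : ℝ) (hγ : 0 < γ₁) (hk : 0 < k) (h𝔠 : 0 < 𝔠)
    (hM : 0 < M₁) (hMlt : M₁ < k * 𝔠) :
    (∃! Yb : ℝ, M₁ * Real.exp (-Yb) - k * 𝔠 - γ₁ * Yb = 0) ∧
    ∀ Yb : ℝ, M₁ * Real.exp (-Yb) - k * 𝔠 - γ₁ * Yb = 0 →
      Yb < 0 ∧
      (∀ X Y : ℝ, Yb < Y →
        M₁ * Real.cos X * Real.exp (-Y) - k * 𝔠 - γ₁ * Y < 0) ∧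
      deriv (deriv (fun X => H₁ M₁ (k * 𝔠) γ₁ X Yb)) 0 = M₁ * Real.exp (-Yb) ∧
      deriv (deriv (fun Y => H₁ M₁ (k * 𝔠) γ₁ 0 Y)) Yb
        = -M₁ * Real.exp (-Yb) - γ₁ ∧
      deriv (fun X => deriv (fun Y => H₁ M₁ (k * 𝔠) γ₁ X Y) Yb) 0 = 0 ∧
      0 < M₁ * Real.exp (-Yb) ∧
      -M₁ * Real.exp (-Yb) - γ₁ < 0 ∧
      ¬ IsLocalMax (fun p : ℝ × ℝ => H₁ M₁ (k * 𝔠) γ₁ p.1 p.2) (0, Yb) ∧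
      ¬ IsLocalMin (fun p : ℝ × ℝ => H₁ M₁ (k * 𝔠) γ₁ p.1 p.2) (0, Yb) := by
  have hanti := strictAnti_crest_profile hM hγ (k * 𝔠)
  constructor
  · obtain ⟨Y, hY⟩ := exists_crest_profile_eq_zero hM hγ hMlt
    exact ⟨Y, hY, fun Z hZ => hanti.injective (hZ.trans hY.symm)⟩
  intro Yb hYb
  have hpos : 0 < M₁ * Real.exp (-Yb) := mul_pos hM (Real.exp_pos _)
  refine ⟨?_, ?_, ?_, ?_, ?_, hpos, by linarith, not_isLocalMax_H₁ hM _ _ _,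
    not_isLocalMin_H₁ hM hγ hYb⟩
  · refine hanti.lt_iff_gt.mp ?_
    simpa [hYb] using hMlt
  · intro X Y hY
    have h₁ : M₁ * Real.exp (-Y) - k * 𝔠 - γ₁ * Y < 0 := hYb ▸ hanti hY
    have h₂ := mul_le_mul_of_nonneg_left (Real.cos_le_one X)
      (mul_pos hM (Real.exp_pos (-Y))).le
    linarith
  · rw [funext fun X => (hasDerivAt_H₁_fst M₁ (k * 𝔠) γ₁ X Yb).deriv]
    simp
  · rw [funext fun Y => (hasDerivAt_H₁_snd M₁ (k * 𝔠) γ₁ 0 Y).deriv]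
    have h := ((((hasDerivAt_id Yb).neg.exp).const_mul (M₁ * Real.cos 0)).sub_const
      (k * 𝔠)).sub ((hasDerivAt_id Yb).const_mul γ₁)
    refine h.deriv.trans ?_
    simp
  · rw [funext fun X => (hasDerivAt_H₁_snd M₁ (k * 𝔠) γ₁ X Yb).deriv]
    simp
end

section
/- Let k > 0, h₁ > 0, γ₁ > 0, 𝔠 > 0, ε₁ ∈ (0,1), M₁ := ε₁·k𝔠, and ω := k𝔠 + γ₁·kh₁. If ε₁·(ω/γ₁)·e^{ω/γ₁} < e^{−1}, then the equation M₁·e^{−Y} + k𝔠 + γ₁·Y = 0 has exactly two real solutions Y⁻ < Y⁺, both solutions are negative, and they satisfy M₁·e^{−Y⁺} < γ₁ < M₁·e^{−Y⁻}; consequently (π, Y⁺) is a nondegenerate local maximum of the Hamiltonian H₁ (a centre of the system) and (π, Y⁻) is a nondegenerate saddle point of H₁. -/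
/-- At a critical point with positive second derivative a function has no local maximum. -/
lemma not_isLocalMax_of_deriv_deriv_pos {f : ℝ → ℝ} {x : ℝ} (hf : 0 < deriv (deriv f) x)
    (hd : deriv f x = 0) (hc : ContinuousAt f x) : ¬ IsLocalMax f x := by
  intro hmax
  have hmin := isLocalMin_of_deriv_deriv_pos hf hd hc
  have hconst : f =ᶠ[nhds x] fun _ => f x := by
    filter_upwards [hmax, hmin] with y h₁ h₂ using le_antisymm h₁ h₂
  have := hconst.deriv.deriv_eq
  simp at this
  exact hf.ne' this

/-- At a critical point with negative second derivative a function has no local minimum. -/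
lemma not_isLocalMin_of_deriv_deriv_neg {f : ℝ → ℝ} {x : ℝ} (hf : deriv (deriv f) x < 0)
    (hd : deriv f x = 0) (hc : ContinuousAt f x) : ¬ IsLocalMin f x := by
  intro hmin
  have hmax := isLocalMax_of_deriv_deriv_neg hf hd hc
  have hconst : f =ᶠ[nhds x] fun _ => f x := by
    filter_upwards [hmax, hmin] with y h₁ h₂ using le_antisymm h₁ h₂
  have := hconst.deriv.deriv_eq
  simp at this
  exact hf.ne this

section Hamiltonian

variable (M ν γ : ℝ)

lemma deriv_H₁_left (Y : ℝ) :
    deriv (fun X => H₁ M ν γ X Y) = fun X => M * Real.sin X * Real.exp (-Y) := by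
  funext X
  have h := ((((Real.hasDerivAt_cos X).const_mul (-M)).mul_const (Real.exp (-Y))).sub_const
    ((γ / 2) * Y ^ 2)).sub_const (ν * Y)
  exact (h.congr_deriv (by ring)).deriv

lemma hasDerivAt_exp_neg (Y : ℝ) : HasDerivAt (fun Y => Real.exp (-Y)) (-Real.exp (-Y)) Y := by
  simpa using (hasDerivAt_neg Y).exp

lemma deriv_H₁_right (X : ℝ) :
    deriv (fun Y => H₁ M ν γ X Y) = fun Y => M * Real.cos X * Real.exp (-Y) - γ * Y - ν := by
  funext Y
  have h := (((hasDerivAt_exp_neg Y).const_mul (-M * Real.cos X)).sub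
    ((hasDerivAt_pow 2 Y).const_mul (γ / 2))).sub ((hasDerivAt_id Y).const_mul ν)
  exact (h.congr_deriv (by push_cast; ring)).deriv

lemma deriv_deriv_H₁_left_pi (Y : ℝ) :
    deriv (deriv (fun X => H₁ M ν γ X Y)) Real.pi = -M * Real.exp (-Y) := by
  rw [deriv_H₁_left]
  have h := ((Real.hasDerivAt_sin Real.pi).const_mul M).mul_const (Real.exp (-Y))
  exact (h.congr_deriv (by rw [Real.cos_pi]; ring)).deriv

lemma deriv_deriv_H₁_right_pi (Y : ℝ) :
    deriv (deriv (fun Y => H₁ M ν γ Real.pi Y)) Y = M * Real.exp (-Y) - γ := by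
  rw [deriv_H₁_right]
  have h := (((hasDerivAt_exp_neg Y).const_mul (M * Real.cos Real.pi)).sub
    ((hasDerivAt_id Y).const_mul γ)).sub_const ν
  exact (h.congr_deriv (by rw [Real.cos_pi]; ring)).deriv

lemma deriv_deriv_H₁_mixed_pi (Y : ℝ) :
    deriv (fun X => deriv (fun Y => H₁ M ν γ X Y) Y) Real.pi = 0 := by
  simp only [deriv_H₁_right]
  have h := ((((Real.hasDerivAt_cos Real.pi).const_mul M).mul_const (Real.exp (-Y))).sub_const
    (γ * Y)).sub_const ν
  exact (h.congr_deriv (by simp)).deriv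

lemma continuous_H₁_left (Y : ℝ) : Continuous fun X => H₁ M ν γ X Y := by
  unfold H₁; fun_prop

lemma continuous_H₁_right (X : ℝ) : Continuous fun Y => H₁ M ν γ X Y := by
  unfold H₁; fun_prop

variable {M ν γ}

lemma deriv_H₁_right_pi_eq_zero {Y : ℝ} (hY : M * Real.exp (-Y) + ν + γ * Y = 0) :
    deriv (fun Y => H₁ M ν γ Real.pi Y) Y = 0 := by
  rw [deriv_H₁_right, Real.cos_pi]
  linarith

lemma H₁_le_H₁_pi (hM : 0 ≤ M) (X Y : ℝ) : H₁ M ν γ X Y ≤ H₁ M ν γ Real.pi Y := by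
  have h : 0 ≤ M * Real.exp (-Y) * (1 + Real.cos X) :=
    mul_nonneg (by positivity) (by linarith [Real.neg_one_le_cos X])
  simp only [H₁, Real.cos_pi]
  linarith

lemma isLocalMax_H₁_pi {Y : ℝ} (hM : 0 ≤ M) (hY : M * Real.exp (-Y) + ν + γ * Y = 0)
    (hlt : M * Real.exp (-Y) < γ) :
    IsLocalMax (fun p : ℝ × ℝ => H₁ M ν γ p.1 p.2) (Real.pi, Y) := by
  have h : IsLocalMax (fun Y => H₁ M ν γ Real.pi Y) Y :=
    isLocalMax_of_deriv_deriv_neg (by rw [deriv_deriv_H₁_right_pi]; linarith)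
      (deriv_H₁_right_pi_eq_zero hY) (continuous_H₁_right M ν γ _).continuousAt
  have hsnd : Filter.Tendsto Prod.snd (nhds (Real.pi, Y)) (nhds Y) :=
    continuous_snd.tendsto (Real.pi, Y)
  filter_upwards [hsnd.eventually h] with p hp
  exact (H₁_le_H₁_pi hM p.1 p.2).trans hp

lemma not_isLocalMax_H₁_pi {Y : ℝ} (hY : M * Real.exp (-Y) + ν + γ * Y = 0)
    (hlt : γ < M * Real.exp (-Y)) :
    ¬ IsLocalMax (fun p : ℝ × ℝ => H₁ M ν γ p.1 p.2) (Real.pi, Y) := by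
  intro h
  refine not_isLocalMax_of_deriv_deriv_pos (f := fun Y => H₁ M ν γ Real.pi Y) (x := Y)
    (by rw [deriv_deriv_H₁_right_pi]; linarith) (deriv_H₁_right_pi_eq_zero hY)
    (continuous_H₁_right M ν γ _).continuousAt ?_
  exact ((Continuous.prodMk_right Real.pi).tendsto Y).eventually h

lemma not_isLocalMin_H₁_pi (hM : 0 < M) (Y : ℝ) :
    ¬ IsLocalMin (fun p : ℝ × ℝ => H₁ M ν γ p.1 p.2) (Real.pi, Y) := by
  intro h
  have hpos : 0 < M * Real.exp (-Y) := by positivity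
  refine not_isLocalMin_of_deriv_deriv_neg (f := fun X => H₁ M ν γ X Y) (x := Real.pi)
    (by rw [deriv_deriv_H₁_left_pi]; linarith) (by simp [deriv_H₁_left])
    (continuous_H₁_left M ν γ _).continuousAt ?_
  exact ((Continuous.prodMk_left Y).tendsto Real.pi).eventually h

end Hamiltonian

section CriticalEquation

variable {M ν γ : ℝ}

/-- The slope `γ` of the chord between two zeros is strictly between the end slopes. -/
lemma slope_bounds_of_zeros {a b : ℝ} (hM : 0 < M) (hab : a < b)
    (ha : M * Real.exp (-a) + ν + γ * a = 0) (hb : M * Real.exp (-b) + ν + γ * b = 0) :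
    M * Real.exp (-b) < γ ∧ γ < M * Real.exp (-a) := by
  have h₁ : b - a + 1 < Real.exp (b - a) := Real.add_one_lt_exp (by linarith)
  have h₂ : a - b + 1 < Real.exp (a - b) := Real.add_one_lt_exp (by linarith)
  have ea : Real.exp (-a) = Real.exp (-b) * Real.exp (b - a) := by
    rw [← Real.exp_add]; ring_nf
  have eb : Real.exp (-b) = Real.exp (-a) * Real.exp (a - b) := by
    rw [← Real.exp_add]; ring_nf
  have k₁ := mul_lt_mul_of_pos_left h₁ (mul_pos hM (Real.exp_pos (-b)))
  have k₂ := mul_lt_mul_of_pos_left h₂ (mul_pos hM (Real.exp_pos (-a)))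
  rw [mul_assoc M _ (Real.exp _), ← ea] at k₁
  rw [mul_assoc M _ (Real.exp _), ← eb] at k₂
  have hba : 0 < b - a := sub_pos.2 hab
  constructor
  · refine lt_of_mul_lt_mul_right ?_ hba.le
    linarith
  · refine lt_of_mul_lt_mul_right ?_ hba.le
    linarith

lemma eq_or_eq_of_zeros {a b y : ℝ} (hM : 0 < M) (hab : a < b)
    (ha : M * Real.exp (-a) + ν + γ * a = 0) (hb : M * Real.exp (-b) + ν + γ * b = 0)
    (hy : M * Real.exp (-y) + ν + γ * y = 0) : y = a ∨ y = b := by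
  have hs := slope_bounds_of_zeros hM hab ha hb
  rcases lt_trichotomy y a with h | h | h
  · linarith [(slope_bounds_of_zeros hM h hy ha).1]
  · exact Or.inl h
  · rcases lt_trichotomy y b with h' | h' | h'
    · linarith [(slope_bounds_of_zeros hM h ha hy).1, (slope_bounds_of_zeros hM h' hy hb).2]
    · exact Or.inr h'
    · linarith [(slope_bounds_of_zeros hM h' hb hy).2]

lemma exists_zeros (hM : 0 < M) (hν : 0 < ν) (hγ : 0 < γ)
    (h : M / γ * Real.exp (ν / γ) < Real.exp (-1)) :
    ∃ a b : ℝ, a < b ∧ b < 0 ∧ M * Real.exp (-a) + ν + γ * a = 0 ∧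
      M * Real.exp (-b) + ν + γ * b = 0 := by
  set f : ℝ → ℝ := fun y => M * Real.exp (-y) + ν + γ * y with hf
  have hcont : Continuous f := by fun_prop
  have hMγ : 0 < M / γ := div_pos hM hγ
  set m := Real.log (M / γ) with hm
  have hexp : Real.exp m = M / γ := Real.exp_log hMγ
  have hlt : m + ν / γ < -1 := by
    rwa [← hexp, ← Real.exp_add, Real.exp_lt_exp] at h
  have hm0 : m < 0 := by linarith [div_pos hν hγ]
  have hfm : f m < 0 := by
    have h₁ : M * Real.exp (-m) = γ := by
      rw [Real.exp_neg, hexp]; field_simp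
    have h₂ := mul_lt_mul_of_pos_left hlt hγ
    rw [mul_add, mul_div_cancel₀ _ hγ.ne'] at h₂
    simp only [hf, h₁]
    linarith
  have hf0 : 0 < f 0 := by simp only [hf]; simp; linarith
  set t := 2 * γ / M with ht
  have htpos : 0 < t := by positivity
  have hMt : M * t = 2 * γ := by rw [ht]; field_simp
  have hft : 0 < f (-t) := by
    have h₁ := mul_le_mul_of_nonneg_left (Real.quadratic_le_exp_of_nonneg htpos.le) hM.le
    have h₂ : M * (1 + t + t ^ 2 / 2) = M + M * t + M * t * t / 2 := by ring
    simp only [hf, neg_neg]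
    rw [h₂, hMt] at h₁
    linarith
  have htm : -t < m := by
    have h₁ : -m + 1 ≤ Real.exp (-m) := Real.add_one_le_exp _
    have h₂ : Real.exp (-m) = t / 2 := by
      rw [Real.exp_neg, hexp, ht]; field_simp
    linarith
  obtain ⟨a, ⟨-, ha⟩, hfa⟩ := intermediate_value_Ioo' htm.le hcont.continuousOn ⟨hfm, hft⟩
  obtain ⟨b, ⟨hb, hb0⟩, hfb⟩ := intermediate_value_Ioo hm0.le hcont.continuousOn ⟨hfm, hf0⟩
  exact ⟨a, b, ha.trans hb, hb0, hfa, hfb⟩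

end CriticalEquation

/-- in the regime `A = 1`, `γ₁ > 0`, `𝔠 > 0`, under the
steepness condition `ε₁ (ω/γ₁) e^{ω/γ₁} < e^{−1}` the equation
`M₁e^{−Y} + k𝔠 + γ₁Y = 0` has exactly two (negative) real solutions
`Y⁻ < Y⁺`, with `M₁e^{−Y⁺} < γ₁ < M₁e^{−Y⁻}`; `(π,Y⁺)` is a nondegenerate
local maximum (centre) of `H₁` and `(π,Y⁻)` a nondegenerate saddle. -/
theorem stmt5 (k h₁ γ₁ 𝔠 ε₁ M₁ ω : ℝ)
    (hk : 0 < k) (hh₁ : 0 < h₁) (hγ : 0 < γ₁) (h𝔠 : 0 < 𝔠)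
    (hε : 0 < ε₁) (hε1 : ε₁ < 1) (hM : M₁ = ε₁ * (k * 𝔠))
    (hω : ω = k * 𝔠 + γ₁ * (k * h₁))
    (hcond : ε₁ * (ω / γ₁) * Real.exp (ω / γ₁) < Real.exp (-1)) :
    ∃ Ym Yp : ℝ, Ym < Yp ∧ Yp < 0 ∧
      M₁ * Real.exp (-Ym) + k * 𝔠 + γ₁ * Ym = 0 ∧
      M₁ * Real.exp (-Yp) + k * 𝔠 + γ₁ * Yp = 0 ∧
      (∀ Y : ℝ, M₁ * Real.exp (-Y) + k * 𝔠 + γ₁ * Y = 0 → Y = Ym ∨ Y = Yp) ∧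
      M₁ * Real.exp (-Yp) < γ₁ ∧ γ₁ < M₁ * Real.exp (-Ym) ∧
      deriv (deriv (fun X => H₁ M₁ (k * 𝔠) γ₁ X Yp)) Real.pi
        = -M₁ * Real.exp (-Yp) ∧
      deriv (deriv (fun Y => H₁ M₁ (k * 𝔠) γ₁ Real.pi Y)) Yp
        = M₁ * Real.exp (-Yp) - γ₁ ∧
      deriv (fun X => deriv (fun Y => H₁ M₁ (k * 𝔠) γ₁ X Y) Yp) Real.pi = 0 ∧
      -M₁ * Real.exp (-Yp) < 0 ∧ M₁ * Real.exp (-Yp) - γ₁ < 0 ∧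
      IsLocalMax (fun p : ℝ × ℝ => H₁ M₁ (k * 𝔠) γ₁ p.1 p.2) (Real.pi, Yp) ∧
      deriv (deriv (fun X => H₁ M₁ (k * 𝔠) γ₁ X Ym)) Real.pi
        = -M₁ * Real.exp (-Ym) ∧
      deriv (deriv (fun Y => H₁ M₁ (k * 𝔠) γ₁ Real.pi Y)) Ym
        = M₁ * Real.exp (-Ym) - γ₁ ∧
      deriv (fun X => deriv (fun Y => H₁ M₁ (k * 𝔠) γ₁ X Y) Ym) Real.pi = 0 ∧
      -M₁ * Real.exp (-Ym) < 0 ∧ 0 < M₁ * Real.exp (-Ym) - γ₁ ∧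
      ¬ IsLocalMax (fun p : ℝ × ℝ => H₁ M₁ (k * 𝔠) γ₁ p.1 p.2) (Real.pi, Ym) ∧
      ¬ IsLocalMin (fun p : ℝ × ℝ => H₁ M₁ (k * 𝔠) γ₁ p.1 p.2) (Real.pi, Ym) := by
  have hν : 0 < k * 𝔠 := mul_pos hk h𝔠
  have hM0 : 0 < M₁ := hM ▸ mul_pos hε hν
  have hνω : k * 𝔠 / γ₁ ≤ ω / γ₁ := by
    have : 0 < γ₁ * (k * h₁) := by positivity
    gcongr
    linarith
  have hsmall : M₁ / γ₁ * Real.exp (k * 𝔠 / γ₁) < Real.exp (-1) := by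
    refine lt_of_le_of_lt ?_ hcond
    rw [hM, mul_div_assoc]
    have : 0 ≤ ω / γ₁ := (div_pos hν hγ).le.trans hνω
    gcongr
  obtain ⟨a, b, hab, hb0, ha, hb⟩ := exists_zeros hM0 hν hγ hsmall
  obtain ⟨hlt, hgt⟩ := slope_bounds_of_zeros hM0 hab ha hb
  have hneg (Y : ℝ) : -M₁ * Real.exp (-Y) < 0 :=
    mul_neg_of_neg_of_pos (neg_lt_zero.2 hM0) (Real.exp_pos _)
  exact ⟨a, b, hab, hb0, ha, hb, fun _ hY => eq_or_eq_of_zeros hM0 hab ha hb hY, hlt, hgt,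
    deriv_deriv_H₁_left_pi _ _ _ _, deriv_deriv_H₁_right_pi _ _ _ _,
    deriv_deriv_H₁_mixed_pi _ _ _ _, hneg b, sub_neg.2 hlt, isLocalMax_H₁_pi hM0.le hb hlt,
    deriv_deriv_H₁_left_pi _ _ _ _, deriv_deriv_H₁_right_pi _ _ _ _,
    deriv_deriv_H₁_mixed_pi _ _ _ _, hneg a, sub_pos.2 hgt, not_isLocalMax_H₁_pi ha hgt,
    not_isLocalMin_H₁_pi hM0 a⟩
end

section
/- Let A ∈ (−1,1), let γ₁ ≠ 0, m ≠ 0 and ν be real numbers, and suppose z₁ := −γ₁/(√(1−A²)·m) > 1. Set L := (1/2)·log((1+A)/(1−A)), Y± := L ± arcosh(z₁), and F(Y) := m·(A·cosh Y − sinh Y) − ν − γ₁·Y. Then: (a) Y⁺ and Y⁻ are exactly the real solutions of m·(A·sinh Y − cosh Y) = γ₁, i.e. the critical points of F; (b) F(Y±) = γ₁·[±(tanh(arcosh z₁) − arcosh z₁) − ν/γ₁ − L]; (c) F(Y⁺)·F(Y⁻) = γ₁²·[(ν/γ₁ + L)² − (tanh(arcosh z₁) − arcosh z₁)²]; and (d)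 F(Y⁺)·F(Y⁻) < 0 if and only if arcosh(z₁) − tanh(arcosh(z₁)) > |ν/γ₁ + L|. -/
/-- The inverse hyperbolic cosine (principal branch), for `x ≥ 1`. -/
noncomputable def arcosh (x : ℝ) : ℝ :=
  Real.log (x + Real.sqrt (x ^ 2 - 1))

theorem Real.cosh_eq_cosh_iff (x y : ℝ) : Real.cosh x = Real.cosh y ↔ x = y ∨ x = -y := by
  rw [← abs_eq_abs, le_antisymm_iff, le_antisymm_iff, Real.cosh_le_cosh, Real.cosh_le_cosh]

theorem Real.sinh_le_mul_cosh {x : ℝ} (hx : 0 ≤ x) : Real.sinh x ≤ x * Real.cosh x := by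
  have hderiv (y : ℝ) : HasDerivAt (fun t => t * Real.cosh t - Real.sinh t)
      (y * Real.sinh y) y :=
    (((hasDerivAt_id y).mul (Real.hasDerivAt_cosh y)).sub
      (Real.hasDerivAt_sinh y)).congr_deriv (by simp)
  have hmono : MonotoneOn (fun t : ℝ => t * Real.cosh t - Real.sinh t) (Set.Ici 0) := by
    refine monotoneOn_of_hasDerivWithinAt_nonneg (convex_Ici 0)
      (fun y _ => (hderiv y).continuousAt.continuousWithinAt)
      (fun y _ => (hderiv y).hasDerivWithinAt) fun y hy => ?_
    have hy' : 0 ≤ y := interior_subset hy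
    exact mul_nonneg hy' (Real.sinh_nonneg_iff.2 hy')
  have h := hmono Set.self_mem_Ici hx hx
  simpa using h

theorem Real.tanh_le_self {x : ℝ} (hx : 0 ≤ x) : Real.tanh x ≤ x := by
  rw [Real.tanh_eq_sinh_div_cosh, div_le_iff₀ (Real.cosh_pos x)]
  exact Real.sinh_le_mul_cosh hx

/-- critical points and critical values of
`F(Y) = m(A cosh Y − sinh Y) − ν − γ₁Y` when `|A| < 1` and
`z₁ = −γ₁/(√(1−A²) m) > 1`. -/
theorem stmt12 (A γ₁ m ν z₁ L Yp Ym : ℝ)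
    (hA : -1 < A) (hA' : A < 1) (hγ : γ₁ ≠ 0) (hm : m ≠ 0)
    (hz : z₁ = -γ₁ / (Real.sqrt (1 - A ^ 2) * m)) (hz1 : 1 < z₁)
    (hL : L = (1 / 2) * Real.log ((1 + A) / (1 - A)))
    (hYp : Yp = L + arcosh z₁) (hYm : Ym = L - arcosh z₁)
    (F : ℝ → ℝ)
    (hF : F = fun Y => m * (A * Real.cosh Y - Real.sinh Y) - ν - γ₁ * Y) :
    (∀ Y : ℝ, m * (A * Real.sinh Y - Real.cosh Y) = γ₁ ↔ (Y = Yp ∨ Y = Ym)) ∧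
    (∀ Y : ℝ, deriv F Y = 0 ↔ (Y = Yp ∨ Y = Ym)) ∧
    F Yp = γ₁ * ((Real.tanh (arcosh z₁) - arcosh z₁) - ν / γ₁ - L) ∧
    F Ym = γ₁ * (-(Real.tanh (arcosh z₁) - arcosh z₁) - ν / γ₁ - L) ∧
    F Yp * F Ym
      = γ₁ ^ 2 * ((ν / γ₁ + L) ^ 2
          - (Real.tanh (arcosh z₁) - arcosh z₁) ^ 2) ∧
    (F Yp * F Ym < 0 ↔
      arcosh z₁ - Real.tanh (arcosh z₁) > |ν / γ₁ + L|) := by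
  have hs : 0 < Real.sqrt (1 - A ^ 2) := Real.sqrt_pos.2 (by nlinarith)
  have hLA : L = Real.artanh A := by
    rw [hL, Real.artanh_eq_half_log ⟨hA.le, hA'.le⟩]
  have hcL : Real.cosh L * Real.sqrt (1 - A ^ 2) = 1 := by
    rw [hLA, Real.cosh_artanh ⟨hA, hA'⟩, one_div_mul_cancel hs.ne']
  have hsL : Real.sinh L * Real.sqrt (1 - A ^ 2) = A := by
    rw [hLA, Real.sinh_artanh ⟨hA, hA'⟩, div_mul_cancel₀ _ hs.ne']
  have hca : Real.cosh (arcosh z₁) = z₁ := Real.cosh_arcosh hz1.le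
  have ha : 0 ≤ arcosh z₁ := Real.arcosh_nonneg hz1.le
  set a := arcosh z₁
  set s := Real.sqrt (1 - A ^ 2)
  have hγz : γ₁ = -(m * s * z₁) := by
    rw [hz]
    field_simp
  have hcosh (u : ℝ) : A * Real.sinh (L + u) - Real.cosh (L + u) = -(s * Real.cosh u) := by
    rw [Real.sinh_add, Real.cosh_add]
    linear_combination (-Real.sinh L * Real.cosh u - Real.cosh L * Real.sinh u) * hsL
      + (Real.cosh L * Real.cosh u + Real.sinh L * Real.sinh u) * hcL
      - s * Real.cosh u * Real.cosh_sq L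
  have hsinh (u : ℝ) : A * Real.cosh (L + u) - Real.sinh (L + u) = -(s * Real.sinh u) := by
    rw [Real.sinh_add, Real.cosh_add]
    linear_combination (-Real.cosh L * Real.cosh u - Real.sinh L * Real.sinh u) * hsL
      + (Real.sinh L * Real.cosh u + Real.cosh L * Real.sinh u) * hcL
      - s * Real.sinh u * Real.cosh_sq L
  have hcrit (Y : ℝ) : m * (A * Real.sinh Y - Real.cosh Y) = γ₁ ↔ Y = Yp ∨ Y = Ym := by
    have hY : Y = L + (Y - L) := by ring
    rw [hY, hcosh, hγz, ← hca, hYp, hYm, ← hY]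
    have hms : m * s ≠ 0 := mul_ne_zero hm hs.ne'
    rw [show m * -(s * Real.cosh (Y - L)) = -(m * s * Real.cosh (Y - L)) by ring, neg_inj,
      mul_right_inj' hms, Real.cosh_eq_cosh_iff, sub_eq_iff_eq_add', sub_eq_iff_eq_add',
      ← sub_eq_add_neg]
  have hderiv (Y : ℝ) : deriv F Y = m * (A * Real.sinh Y - Real.cosh Y) - γ₁ := by
    rw [hF]
    have h := (((((Real.hasDerivAt_cosh Y).const_mul A).sub (Real.hasDerivAt_sinh Y)).const_mul
      m).sub_const ν).sub ((hasDerivAt_id Y).const_mul γ₁)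
    exact h.deriv.trans (by ring)
  have htanh : m * s * Real.sinh a = -(γ₁ * Real.tanh a) := by
    rw [Real.tanh_eq_sinh_div_cosh, hca, hγz]
    field_simp
  have hFp : F Yp = γ₁ * ((Real.tanh a - a) - ν / γ₁ - L) := by
    simp only [hF, hYp, hsinh]
    field_simp
    linear_combination -htanh
  have hFm : F Ym = γ₁ * (-(Real.tanh a - a) - ν / γ₁ - L) := by
    simp only [hF, hYm, sub_eq_add_neg L a, hsinh, Real.sinh_neg]
    field_simp
    linear_combination htanh
  have hprod : F Yp * F Ym
      = γ₁ ^ 2 * ((ν / γ₁ + L) ^ 2 - (Real.tanh a - a) ^ 2) := by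
    rw [hFp, hFm]
    ring
  refine ⟨hcrit, fun Y => ?_, hFp, hFm, hprod, ?_⟩
  · rw [hderiv, sub_eq_zero, hcrit]
  · rw [hprod, ← neg_pos, ← mul_neg, mul_pos_iff_of_pos_left (by positivity), neg_sub, sub_pos,
      sq_lt_sq, abs_sub_comm, abs_of_nonneg (sub_nonneg.2 (Real.tanh_le_self ha))]
end

section
/- Let A ∈ (−1,1), k > 0, 𝔠 > 0, γ₁ > 0, ε₁ ∈ (0,1), set M₁ := ε₁·k𝔠 and ℜ := √(1−A²)·M₁/γ₁, and assume 0 < ℜ < 1 and arcosh(1/ℜ) − tanh(arcosh(1/ℜ)) > |k𝔠/γ₁ + (1/2)·log((1+A)/(1−A))|. Then the set of singular points {(X,Y) ∈ [−π,π]×ℝ : F(X,Y) = 0 and G(X,Y) = 0} has exactly 7 elements; more precisely, all singular points satisfy X ∈ {−π, 0, π}, the function Y ↦ F(0,Y) has exactly one real zero, and the function Y ↦ F(π,Y) = F(−π,Y) has exactly three real zeros. -/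
/-- Horizontal velocity `F(X,Y) = M₁ cos X (A cosh Y − sinh Y) − ν − γ₁Y`
of the upper-layer travelling-wave system, with `ν = k𝔠`. -/
noncomputable def Fup (M₁ ν γ₁ A X Y : ℝ) : ℝ :=
  M₁ * Real.cos X * (A * Real.cosh Y - Real.sinh Y) - ν - γ₁ * Y

/-- Vertical velocity `G(X,Y) = M₁ sin X (A sinh Y − cosh Y)`. -/
noncomputable def Gup (M₁ A X Y : ℝ) : ℝ :=
  M₁ * Real.sin X * (A * Real.sinh Y - Real.cosh Y)

/-- With `b = artanh A`, the combination `A cosh Y - sinh Y` is a shifted hyperbolic sine. -/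
lemma mul_cosh_sub_sinh_eq {A : ℝ} (hA : -1 < A) (hA' : A < 1) (Y : ℝ) :
    A * Real.cosh Y - Real.sinh Y = -(Real.sqrt (1 - A ^ 2) *
      Real.sinh (Y - (1 / 2) * Real.log ((1 + A) / (1 - A)))) := by
  set b := (1 / 2) * Real.log ((1 + A) / (1 - A)) with hb
  have h1 : 0 < 1 + A := by linarith
  have h2 : 0 < 1 - A := by linarith
  have hs : Real.sqrt (1 - A ^ 2) ^ 2 = 1 - A ^ 2 := Real.sq_sqrt (by nlinarith)
  have he : Real.exp b ^ 2 = (1 + A) / (1 - A) := by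
    rw [← Real.exp_nat_mul, hb]
    rw [show ((2 : ℕ) : ℝ) * (1 / 2 * Real.log ((1 + A) / (1 - A)))
      = Real.log ((1 + A) / (1 - A)) by push_cast; ring]
    exact Real.exp_log (by positivity)
  have hse : Real.sqrt (1 - A ^ 2) * Real.exp b = 1 + A := by
    refine (sq_eq_sq₀ (by positivity) h1.le).1 ?_
    rw [mul_pow, hs, he]
    field_simp
    ring
  have hse' : Real.sqrt (1 - A ^ 2) * Real.exp (-b) = 1 - A := by
    have hmul : Real.exp b * Real.exp (-b) = 1 := by rw [← Real.exp_add]; simp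
    have hsq : Real.sqrt (1 - A ^ 2) * Real.sqrt (1 - A ^ 2) = (1 + A) * (1 - A) := by
      linear_combination hs
    have : (1 + A) * (Real.sqrt (1 - A ^ 2) * Real.exp (-b)) = (1 + A) * (1 - A) := by
      linear_combination hsq - Real.sqrt (1 - A ^ 2) * Real.exp (-b) * hse
        + Real.sqrt (1 - A ^ 2) ^ 2 * hmul
    exact mul_left_cancel₀ h1.ne' this
  rw [Real.sinh_sub, Real.cosh_eq b, Real.sinh_eq b]
  linear_combination (Real.sinh Y - Real.cosh Y) / 2 * hse + (Real.sinh Y + Real.cosh Y) / 2 * hse'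

lemma continuous_mul_sinh_sub (R d : ℝ) :
    Continuous fun x : ℝ => R * Real.sinh x - x - d := by fun_prop

lemma hasDerivAt_mul_sinh_sub (R d x : ℝ) :
    HasDerivAt (fun x : ℝ => R * Real.sinh x - x - d) (R * Real.cosh x - 1) x :=
  (((Real.hasDerivAt_sinh x).const_mul R).sub (hasDerivAt_id x)).sub_const d

lemma exists_pos_mul_sinh_sub {R : ℝ} (hR : 0 < R) (d z : ℝ) :
    ∃ x, z < x ∧ 0 < R * Real.sinh x - x - d := by
  set x := |z| + 4 * (1 + |d|) / R + 1 with hx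
  have hq : 0 < 4 * (1 + |d|) / R := by positivity
  have hx1 : 1 ≤ x := by linarith [abs_nonneg z]
  have hx0 : 0 < x := by linarith
  refine ⟨x, by linarith [le_abs_self z], ?_⟩
  have h1 := Real.quadratic_le_exp_of_nonneg hx0.le
  have h2 : Real.exp (-x) ≤ 1 := Real.exp_le_one_iff.2 (by linarith)
  have h3 : x ^ 2 / 4 < Real.sinh x := by
    rw [Real.sinh_eq]
    nlinarith
  have h4 : 4 * (1 + |d|) ≤ R * x := by
    have h : R * (4 * (1 + |d|) / R) = 4 * (1 + |d|) := by field_simp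
    nlinarith [abs_nonneg z]
  have h5 : R * (x ^ 2 / 4) < R * Real.sinh x := mul_lt_mul_of_pos_left h3 hR
  have h6 : |d| ≤ |d| * x := le_mul_of_one_le_right (abs_nonneg d) hx1
  nlinarith [le_abs_self d, mul_le_mul_of_nonneg_right h4 hx0.le]

/-- A cubic-shaped combination `R sinh x - x - d` has exactly three zeros when `|d|` is smaller
than its local extreme value `z - tanh z`. -/
lemma exists_three_zeros_mul_sinh_sub {R d z : ℝ} (hR : 0 < R) (hz : 0 < z)
    (hc : R * Real.cosh z = 1) (hd : |d| < z - Real.tanh z) :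
    ∃ a b c, a < b ∧ b < c ∧
      ∀ x, R * Real.sinh x - x - d = 0 ↔ x = a ∨ x = b ∨ x = c := by
  set g : ℝ → ℝ := fun x => R * Real.sinh x - x - d with hg
  have hcont : Continuous g := continuous_mul_sinh_sub R d
  have hderiv (x : ℝ) : deriv g x = R * Real.cosh x - 1 := (hasDerivAt_mul_sinh_sub R d x).deriv
  have hcosh : ∀ x y : ℝ, |x| < |y| → R * Real.cosh x < R * Real.cosh y := fun x y h =>
    mul_lt_mul_of_pos_left (Real.cosh_lt_cosh.2 h) hR
  have hzz : |z| = z := abs_of_pos hz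
  have hmono1 : StrictMonoOn g (Set.Iic (-z)) := by
    refine strictMonoOn_of_deriv_pos (convex_Iic _) hcont.continuousOn fun x hx => ?_
    rw [interior_Iic, Set.mem_Iio] at hx
    have := hcosh z x (by rw [hzz, abs_of_neg (by linarith)]; linarith)
    rw [hderiv]; linarith
  have hanti : StrictAntiOn g (Set.Icc (-z) z) := by
    refine strictAntiOn_of_deriv_neg (convex_Icc _ _) hcont.continuousOn fun x hx => ?_
    rw [interior_Icc] at hx
    have := hcosh x z (by rw [hzz]; exact abs_lt.2 hx)
    rw [hderiv]; linarith
  have hmono2 : StrictMonoOn g (Set.Ici z) := by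
    refine strictMonoOn_of_deriv_pos (convex_Ici _) hcont.continuousOn fun x hx => ?_
    rw [interior_Ici, Set.mem_Ioi] at hx
    have := hcosh z x (by rw [hzz, abs_of_pos (by linarith)]; linarith)
    rw [hderiv]; linarith
  have htanh : R * Real.sinh z = Real.tanh z := by
    rw [Real.tanh_eq_sinh_div_cosh, eq_div_iff (Real.cosh_pos z).ne']
    linear_combination Real.sinh z * hc
  obtain ⟨hd1, hd2⟩ := abs_lt.1 hd
  have hgz : g z < 0 := by simp only [hg]; linarith
  have hgz' : 0 < g (-z) := by simp only [hg, Real.sinh_neg]; linarith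
  obtain ⟨u, hu, hgu⟩ := exists_pos_mul_sinh_sub hR d z
  obtain ⟨v, hv, hgv⟩ := exists_pos_mul_sinh_sub hR (-d) z
  have hgv' : g (-v) < 0 := by simp only [hg, Real.sinh_neg]; linarith
  obtain ⟨a, ha, hga⟩ := intermediate_value_Ioo (by linarith : -v ≤ -z) hcont.continuousOn
    ⟨hgv', hgz'⟩
  obtain ⟨b, hb, hgb⟩ := intermediate_value_Ioo' (by linarith : -z ≤ z) hcont.continuousOn
    ⟨hgz, hgz'⟩
  obtain ⟨c, hc', hgc⟩ := intermediate_value_Ioo hu.le hcont.continuousOn ⟨hgz, hgu⟩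
  refine ⟨a, b, c, ha.2.trans hb.1, hb.2.trans hc'.1, fun x => ⟨fun hx => ?_, ?_⟩⟩
  · change g x = 0 at hx
    rcases le_total x (-z) with h | h
    · exact .inl (hmono1.injOn h ha.2.le (hx.trans hga.symm))
    rcases le_total x z with h' | h'
    · exact .inr (.inl (hanti.injOn ⟨h, h'⟩ ⟨hb.1.le, hb.2.le⟩ (hx.trans hgb.symm)))
    · exact .inr (.inr (hmono2.injOn h' hc'.1.le (hx.trans hgc.symm)))
  · rintro (rfl | rfl | rfl) <;> assumption

lemma exists_unique_zero_mul_sinh_add {R : ℝ} (hR : 0 < R) (d : ℝ) :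
    ∃ a, ∀ x, R * Real.sinh x + x + d = 0 ↔ x = a := by
  set g : ℝ → ℝ := fun x => R * Real.sinh x + x + d with hg
  have hcont : Continuous g := by fun_prop
  have hmono : StrictMono g := fun x y h => by
    have := mul_lt_mul_of_pos_left (Real.sinh_lt_sinh.2 h) hR
    simp only [hg]; linarith
  have hs : 0 ≤ R * Real.sinh |d| := mul_nonneg hR.le (Real.sinh_nonneg_iff.2 (abs_nonneg d))
  have h1 : g (-|d|) ≤ 0 := by
    simp only [hg, Real.sinh_neg]; linarith [le_abs_self d]
  have h2 : 0 ≤ g |d| := by simp only [hg]; linarith [neg_abs_le d]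
  obtain ⟨a, -, ha⟩ := intermediate_value_Icc (by linarith [abs_nonneg d] : -|d| ≤ |d|)
    hcont.continuousOn ⟨h1, h2⟩
  exact ⟨a, fun x => ⟨fun hx => hmono.injective ((show g x = 0 from hx).trans ha.symm),
    fun hx => hx ▸ ha⟩⟩

lemma Gup_eq_zero_iff {M₁ A : ℝ} (hM : M₁ ≠ 0) (hA : -1 < A) (hA' : A < 1) (X Y : ℝ) :
    Gup M₁ A X Y = 0 ↔ Real.sin X = 0 := by
  have h : A * Real.sinh Y - Real.cosh Y ≠ 0 := by
    have h1 := Real.exp_pos Y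
    have h2 := Real.exp_pos (-Y)
    rw [Real.sinh_eq, Real.cosh_eq]
    nlinarith
  simp [Gup, hM, h]

lemma sin_eq_zero_iff_of_mem_Icc {X : ℝ} (hX : X ∈ Set.Icc (-Real.pi) Real.pi) :
    Real.sin X = 0 ↔ X = -Real.pi ∨ X = 0 ∨ X = Real.pi := by
  refine ⟨fun h => ?_, by rintro (rfl | rfl | rfl) <;> simp⟩
  rcases hX.1.eq_or_lt with h1 | h1
  · exact .inl h1.symm
  rcases hX.2.eq_or_lt with h2 | h2
  · exact .inr (.inr h2)
  · exact .inr (.inl ((Real.sin_eq_zero_iff_of_lt_of_lt h1 h2).1 h))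

/-- for `|A| < 1`, `γ₁ > 0`, `𝔠 > 0`, `0 < ℜ < 1` satisfying the
condition `arcosh(1/ℜ) − tanh(arcosh(1/ℜ)) > |k𝔠/γ₁ + ½log((1+A)/(1−A))|`,
the system has exactly `7` singular points in `[−π,π] × ℝ`: all lie on
`X ∈ {−π,0,π}`, with `F(0,·)` having one zero and `F(±π,·)` three. -/
theorem stmt13 (A k 𝔠 γ₁ ε₁ M₁ R : ℝ) (hA : -1 < A) (hA' : A < 1)
    (hk : 0 < k) (h𝔠 : 0 < 𝔠) (hγ : 0 < γ₁) (hε : 0 < ε₁) (hε1 : ε₁ < 1)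
    (hM : M₁ = ε₁ * (k * 𝔠)) (hR : R = Real.sqrt (1 - A ^ 2) * M₁ / γ₁)
    (hR0 : 0 < R) (hR1 : R < 1)
    (hcond : arcosh (1 / R) - Real.tanh (arcosh (1 / R)) >
      |k * 𝔠 / γ₁ + (1 / 2) * Real.log ((1 + A) / (1 - A))|) :
    {p : ℝ × ℝ | p.1 ∈ Set.Icc (-Real.pi) Real.pi ∧
        Fup M₁ (k * 𝔠) γ₁ A p.1 p.2 = 0 ∧ Gup M₁ A p.1 p.2 = 0}.ncard = 7 ∧
    (∀ p : ℝ × ℝ, p.1 ∈ Set.Icc (-Real.pi) Real.pi →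
        Fup M₁ (k * 𝔠) γ₁ A p.1 p.2 = 0 → Gup M₁ A p.1 p.2 = 0 →
        p.1 = -Real.pi ∨ p.1 = 0 ∨ p.1 = Real.pi) ∧
    {Y : ℝ | Fup M₁ (k * 𝔠) γ₁ A 0 Y = 0}.ncard = 1 ∧
    (∀ Y : ℝ, Fup M₁ (k * 𝔠) γ₁ A Real.pi Y
        = Fup M₁ (k * 𝔠) γ₁ A (-Real.pi) Y) ∧
    {Y : ℝ | Fup M₁ (k * 𝔠) γ₁ A Real.pi Y = 0}.ncard = 3 := by
  have hM0 : 0 < M₁ := by rw [hM]; positivity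
  set β := (1 / 2) * Real.log ((1 + A) / (1 - A)) with hβ
  have hRγ : Real.sqrt (1 - A ^ 2) * M₁ = R * γ₁ := by rw [hR]; field_simp
  have hRinv : 1 < 1 / R := (one_lt_div hR0).2 hR1
  have harc : arcosh (1 / R) = Real.arcosh (1 / R) := rfl
  have hz : 0 < arcosh (1 / R) := harc ▸ Real.arcosh_pos hRinv
  have hcosh : R * Real.cosh (arcosh (1 / R)) = 1 := by
    rw [harc, Real.cosh_arcosh hRinv.le]; field_simp
  obtain ⟨a, b, c, hab, hbc, habc⟩ := exists_three_zeros_mul_sinh_sub hR0 hz hcosh hcond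
  obtain ⟨e, he⟩ := exists_unique_zero_mul_sinh_add hR0 (k * 𝔠 / γ₁ + β)
  have hν : γ₁ * (k * 𝔠 / γ₁) = k * 𝔠 := by field_simp
  have hF0 (Y : ℝ) : Fup M₁ (k * 𝔠) γ₁ A 0 Y
      = -γ₁ * (R * Real.sinh (Y - β) + (Y - β) + (k * 𝔠 / γ₁ + β)) := by
    rw [Fup, mul_cosh_sub_sinh_eq hA hA', Real.cos_zero]
    linear_combination -Real.sinh (Y - β) * hRγ + hν
  have hFπ (Y : ℝ) : Fup M₁ (k * 𝔠) γ₁ A Real.pi Y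
      = γ₁ * (R * Real.sinh (Y - β) - (Y - β) - (k * 𝔠 / γ₁ + β)) := by
    rw [Fup, mul_cosh_sub_sinh_eq hA hA', Real.cos_pi]
    linear_combination Real.sinh (Y - β) * hRγ + hν
  have hFneg (Y : ℝ) : Fup M₁ (k * 𝔠) γ₁ A Real.pi Y = Fup M₁ (k * 𝔠) γ₁ A (-Real.pi) Y := by
    simp [Fup]
  have hS0 : {Y : ℝ | Fup M₁ (k * 𝔠) γ₁ A 0 Y = 0} = {e + β} := by
    ext Y
    simp [hF0, hγ.ne', he, sub_eq_iff_eq_add]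
  have hSπ : {Y : ℝ | Fup M₁ (k * 𝔠) γ₁ A Real.pi Y = 0} = {a + β, b + β, c + β} := by
    ext Y
    simp [hFπ, hγ.ne', habc, sub_eq_iff_eq_add]
  have hcard0 : {Y : ℝ | Fup M₁ (k * 𝔠) γ₁ A 0 Y = 0}.ncard = 1 := by
    rw [hS0, Set.ncard_singleton]
  have hcardπ : {Y : ℝ | Fup M₁ (k * 𝔠) γ₁ A Real.pi Y = 0}.ncard = 3 := by
    rw [hSπ, Set.ncard_eq_three]
    exact ⟨_, _, _, by simpa using hab.ne, by simpa using (hab.trans hbc).ne,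
      by simpa using hbc.ne, rfl⟩
  refine ⟨?_, fun p hp _ hG => (sin_eq_zero_iff_of_mem_Icc hp).1
    ((Gup_eq_zero_iff hM0.ne' hA hA' _ _).1 hG), hcard0, hFneg, hcardπ⟩
  have hset : {p : ℝ × ℝ | p.1 ∈ Set.Icc (-Real.pi) Real.pi ∧
      Fup M₁ (k * 𝔠) γ₁ A p.1 p.2 = 0 ∧ Gup M₁ A p.1 p.2 = 0} =
      {0} ×ˢ {Y : ℝ | Fup M₁ (k * 𝔠) γ₁ A 0 Y = 0} ∪
        {-Real.pi, Real.pi} ×ˢ {Y : ℝ | Fup M₁ (k * 𝔠) γ₁ A Real.pi Y = 0} := by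
    ext ⟨X, Y⟩
    simp only [Set.mem_ofPred_eq, Set.mem_union, Set.mem_prod, Set.mem_singleton_iff,
      Set.mem_insert_iff, Gup_eq_zero_iff hM0.ne' hA hA']
    constructor
    · rintro ⟨hX, hF, hs⟩
      rcases (sin_eq_zero_iff_of_mem_Icc hX).1 hs with rfl | rfl | rfl
      · exact .inr ⟨.inl rfl, (hFneg Y).trans hF⟩
      · exact .inl ⟨rfl, hF⟩
      · exact .inr ⟨.inr rfl, hF⟩
    · have hπ := Real.pi_pos.le
      rintro (⟨rfl, hF⟩ | ⟨rfl | rfl, hF⟩)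
      · exact ⟨⟨by linarith, hπ⟩, hF, by simp⟩
      · exact ⟨⟨le_rfl, by linarith⟩, (hFneg Y).symm.trans hF, by simp⟩
      · exact ⟨⟨by linarith, le_rfl⟩, hF, by simp⟩
  have hfin0 : {Y : ℝ | Fup M₁ (k * 𝔠) γ₁ A 0 Y = 0}.Finite := by rw [hS0]; simp
  have hfinπ : {Y : ℝ | Fup M₁ (k * 𝔠) γ₁ A Real.pi Y = 0}.Finite := by rw [hSπ]; simp
  have hdisj : Disjoint ({0} ×ˢ {Y : ℝ | Fup M₁ (k * 𝔠) γ₁ A 0 Y = 0})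
      ({-Real.pi, Real.pi} ×ˢ {Y : ℝ | Fup M₁ (k * 𝔠) γ₁ A Real.pi Y = 0}) :=
    Set.disjoint_prod.2 (.inl (by simp [Real.pi_ne_zero, Real.pi_ne_zero.symm]))
  have hpair : -Real.pi ≠ Real.pi := by linarith [Real.pi_pos]
  rw [hset, Set.ncard_union_eq hdisj ((Set.finite_singleton _).prod hfin0)
    ((Set.toFinite _).prod hfinπ), Set.ncard_prod, Set.ncard_prod, hcard0, hcardπ,
    Set.ncard_singleton, Set.ncard_pair hpair]
end

section
/- Let A > 1, let m ≠ 0, γ₁ ≠ 0 and ν be real numbers, and set L̃ := (1/2)·log((A+1)/(A−1)), z := γ₁/(m·√(A²−1)), Y⁺ := L̃ + arsinh(z), and F(Y) := m·(A·cosh Y − sinh Y) − ν − γ₁·Y. Then Y⁺ is the unique real solution of m·(A·sinh Y − cosh Y) = γ₁ (the unique critical point of F), and F(Y⁺) = γ₁·coth(arsinh z) − γ₁·arsinh(z) − ν − γ₁·L̃. Consequently, if F₋(Y) := −m·(A·cosh Y − sinh Y) − ν − γ₁·Y and Y⁺₋ := L̃ + arsinh(−z) is its unique critical point, then F₋(Y⁺₋)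 = −F(Y⁺) − 2·(ν + γ₁·L̃). -/
/-- The hyperbolic cotangent `coth x = cosh x / sinh x`. -/
noncomputable def coth (x : ℝ) : ℝ :=
  Real.cosh x / Real.sinh x

/-- With `L = artanh (1 / A)`, the vector `(A, 1)` is `√(A² - 1) • (cosh L, sinh L)`. -/
theorem sqrt_mul_cosh_sinh_half_log {A : ℝ} (hA : 1 < A) :
    Real.sqrt (A ^ 2 - 1) * Real.cosh ((1 / 2) * Real.log ((A + 1) / (A - 1))) = A ∧
    Real.sqrt (A ^ 2 - 1) * Real.sinh ((1 / 2) * Real.log ((A + 1) / (A - 1))) = 1 := by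
  set L := (1 / 2) * Real.log ((A + 1) / (A - 1)) with hL
  have hA' : 0 < A - 1 := by linarith
  have hsq : Real.exp L ^ 2 * (A - 1) = A + 1 := by
    have h : Real.exp L ^ 2 = (A + 1) / (A - 1) := by
      rw [← Real.exp_nat_mul, hL, ← mul_assoc]
      norm_num
      exact Real.exp_log (by positivity)
    rw [h]
    field_simp
  have hs : Real.sqrt (A ^ 2 - 1) = Real.exp L * (A - 1) := by
    rw [Real.sqrt_eq_iff_mul_self_eq_of_pos (by positivity)]
    linear_combination (A - 1) * hsq
  have hinv : Real.exp L * Real.exp (-L) = 1 := by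
    rw [← Real.exp_add, add_neg_cancel, Real.exp_zero]
  rw [hs, Real.cosh_eq, Real.sinh_eq]
  constructor
  · linear_combination (1 / 2) * hsq + (A - 1) / 2 * hinv
  · linear_combination (1 / 2) * hsq - (A - 1) / 2 * hinv

/-- A phase-shifted multiple of `sinh` takes each value exactly once. -/
theorem mul_sinh_sub_eq_iff {c : ℝ} (hc : c ≠ 0) (γ L Y : ℝ) :
    c * Real.sinh (Y - L) = γ ↔ Y = L + Real.arsinh (γ / c) := by
  rw [mul_comm, ← eq_div_iff hc, ← sub_eq_iff_eq_add', ← Real.sinh_inj (x := Y - L),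
    Real.sinh_arsinh]

/-- for `A > 1`, the unique critical point of
`F(Y) = m(A cosh Y − sinh Y) − ν − γ₁Y` is `Y⁺ = L̃ + arsinh z` with
`z = γ₁/(m√(A²−1))`, the critical value is
`F(Y⁺) = γ₁ coth(arsinh z) − γ₁ arsinh z − ν − γ₁ L̃`, and the critical value
of `F₋(Y) = −m(A cosh Y − sinh Y) − ν − γ₁Y` at its unique critical point
`Y⁺₋ = L̃ + arsinh(−z)` satisfies `F₋(Y⁺₋) = −F(Y⁺) − 2(ν + γ₁L̃)`. -/
theorem stmt16 (A m γ₁ ν L z Yp Ypm : ℝ)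
    (hA : 1 < A) (hm : m ≠ 0) (hγ : γ₁ ≠ 0)
    (hL : L = (1 / 2) * Real.log ((A + 1) / (A - 1)))
    (hz : z = γ₁ / (m * Real.sqrt (A ^ 2 - 1)))
    (hYp : Yp = L + Real.arsinh z)
    (hYpm : Ypm = L + Real.arsinh (-z))
    (F Fm : ℝ → ℝ)
    (hF : F = fun Y => m * (A * Real.cosh Y - Real.sinh Y) - ν - γ₁ * Y)
    (hFm : Fm = fun Y => -m * (A * Real.cosh Y - Real.sinh Y) - ν - γ₁ * Y) :
    (∀ Y : ℝ, m * (A * Real.sinh Y - Real.cosh Y) = γ₁ ↔ Y = Yp) ∧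
    (∀ Y : ℝ, deriv F Y = 0 ↔ Y = Yp) ∧
    F Yp = γ₁ * coth (Real.arsinh z) - γ₁ * Real.arsinh z - ν - γ₁ * L ∧
    (∀ Y : ℝ, -m * (A * Real.sinh Y - Real.cosh Y) = γ₁ ↔ Y = Ypm) ∧
    Fm Ypm = -(F Yp) - 2 * (ν + γ₁ * L) := by
  obtain ⟨hc, hs⟩ := sqrt_mul_cosh_sinh_half_log hA
  have hs0 : Real.sqrt (A ^ 2 - 1) ≠ 0 := left_ne_zero_of_mul (hs ▸ one_ne_zero)
  rw [← hL] at hc hs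
  set s := Real.sqrt (A ^ 2 - 1)
  have hcosh (Y : ℝ) : A * Real.cosh Y - Real.sinh Y = s * Real.cosh (Y - L) := by
    rw [Real.cosh_sub]
    linear_combination -Real.cosh Y * hc + Real.sinh Y * hs
  have hsinh (Y : ℝ) : A * Real.sinh Y - Real.cosh Y = s * Real.sinh (Y - L) := by
    rw [Real.sinh_sub]
    linear_combination -Real.sinh Y * hc + Real.cosh Y * hs
  have hcrit (Y : ℝ) : m * (A * Real.sinh Y - Real.cosh Y) = γ₁ ↔ Y = Yp := by
    rw [hsinh, ← mul_assoc, mul_sinh_sub_eq_iff (mul_ne_zero hm hs0), hYp, hz]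
  have hγz : γ₁ = m * s * z := by
    rw [hz]
    field_simp
  have hz0 : z ≠ 0 := right_ne_zero_of_mul (hγz ▸ hγ)
  refine ⟨hcrit, fun Y => ?_, ?_, fun Y => ?_, ?_⟩
  · have hd : HasDerivAt F (m * (A * Real.sinh Y - Real.cosh Y) - γ₁) Y := by
      rw [hF]
      have h := (((((Real.hasDerivAt_cosh Y).const_mul A).sub
        (Real.hasDerivAt_sinh Y)).const_mul m).sub_const ν).sub
        ((hasDerivAt_id Y).const_mul γ₁)
      rw [mul_one] at h
      exact h
    rw [hd.deriv, sub_eq_zero, hcrit]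
  · simp only [hF, hcosh, hYp, coth, Real.sinh_arsinh, add_sub_cancel_left]
    have h : γ₁ * (Real.cosh (Real.arsinh z) / z) = m * s * Real.cosh (Real.arsinh z) := by
      rw [hγz]
      field_simp
    rw [h]
    ring
  · rw [hsinh, ← mul_assoc, mul_sinh_sub_eq_iff (mul_ne_zero (neg_ne_zero.mpr hm) hs0),
      hYpm, hz, neg_mul, div_neg]
  · simp only [hF, hFm, hcosh, hYp, hYpm, add_sub_cancel_left, Real.arsinh_neg, Real.cosh_neg]
    ring
end

section
/- Let A > 1, k > 0, h₁ > 0, 𝔠 > 0, γ₁ < 0, ε₁ ∈ (0,1), set M₁ := ε₁·k𝔠 and L̃ := (1/2)·log((A+1)/(A−1)), let ε be a real number, and let Ỹ be the unique real solution of M₁·(A·sinh Y − cosh Y) = −γ₁. Assume F(π, Ỹ) > 0, F(0, max(kh₁ − ε, L̃)) < 0 and F(0, −ε) < 0. Then the set of singular points {(X,Y) ∈ [−π,π]×ℝ : F(X,Y) = 0 and G(X,Y) = 0} has exactly 6 elements; more precisely, the function Y ↦ F(0,Y) has exactly two real zeros, the function Y ↦ F(π,Y) = F(−π,Y) has exactly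 two real zeros, and F(X, L̃) ≠ 0 for every X ∈ [−π,π], so no singular points occur on the line Y = L̃. -/
theorem StrictConvexOn.exists_zeros_eq_pair {f : ℝ → ℝ} (hf : StrictConvexOn ℝ Set.univ f)
    (hc : Continuous f) {u m v : ℝ} (hum : u < m) (hmv : m < v) (hu : 0 < f u) (hm : f m < 0)
    (hv : 0 < f v) : ∃ a b, a ≠ b ∧ {y | f y = 0} = {a, b} := by
  obtain ⟨a, ha, hfa⟩ := intermediate_value_Ioo' hum.le hc.continuousOn ⟨hm, hu⟩
  obtain ⟨b, hb, hfb⟩ := intermediate_value_Ioo hmv.le hc.continuousOn ⟨hm, hv⟩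
  have no_three : ∀ x y z : ℝ, x < y → y < z → f x = 0 → f y = 0 → f z ≠ 0 := by
    intro x y z hxy hyz hx hy hz
    have h := hf.slope_strict_mono_adjacent (Set.mem_univ x) (Set.mem_univ z) hxy hyz
    simp [hx, hy, hz] at h
  have hab : a < b := ha.2.trans hb.1
  refine ⟨a, b, hab.ne, Set.ext fun y => ⟨fun hy => ?_, ?_⟩⟩
  · by_contra hne
    simp only [Set.mem_insert_iff, Set.mem_singleton_iff, not_or] at hne
    rcases lt_or_gt_of_ne hne.1 with h | h
    · exact no_three y a b h hab hy hfa hfb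
    rcases lt_or_gt_of_ne hne.2 with h' | h'
    · exact no_three a y b h h' hfa hy hfb
    · exact no_three a b y hab h' hfa hfb hy
  · rintro (rfl | rfl)
    exacts [hfa, hfb]

theorem exists_pos_forall_le_abs_quadratic_pos {c : ℝ} (hc : 0 < c) (p q : ℝ) :
    ∃ R : ℝ, ∀ y, R ≤ |y| → 0 < c * y ^ 2 + p * y + q := by
  refine ⟨(|p| + |q|) / c + 1, fun y hy => ?_⟩
  have h0 : 0 ≤ (|p| + |q|) / c := by positivity
  have h1 : 1 ≤ |y| := by linarith
  have h2 : |p| + |q| + c ≤ c * |y| := by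
    calc |p| + |q| + c = c * ((|p| + |q|) / c + 1) := by field_simp
      _ ≤ c * |y| := by gcongr
  have h3 : -(|p| * |y|) ≤ p * y := by
    rw [← abs_mul]
    exact neg_abs_le _
  have h4 := neg_abs_le q
  have h5 : (|p| + |q| + c) * |y| ≤ c * |y| * |y| := by gcongr
  have h6 : |q| * 1 ≤ |q| * |y| := by gcongr
  have h7 : c * 1 ≤ c * |y| := by gcongr
  rw [← sq_abs y]
  nlinarith

theorem strictConvexOn_mul_cosh_sub_sinh_add_linear {A M : ℝ} (hA : 1 < A) (hM : 0 < M)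
    (p q : ℝ) :
    StrictConvexOn ℝ Set.univ
      (fun y => M * (A * Real.cosh y - Real.sinh y) + p * y + q) := by
  have h1 (y : ℝ) : HasDerivAt (fun y => M * (A * Real.cosh y - Real.sinh y) + p * y + q)
      (M * (A * Real.sinh y - Real.cosh y) + p) y := by
    simpa using (((((Real.hasDerivAt_cosh y).const_mul A).sub
      (Real.hasDerivAt_sinh y)).const_mul M).add ((hasDerivAt_id y).const_mul p)).add_const q
  have h2 (y : ℝ) : HasDerivAt (fun y => M * (A * Real.sinh y - Real.cosh y) + p)
      (M * (A * Real.cosh y - Real.sinh y)) y := by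
    simpa using ((((Real.hasDerivAt_sinh y).const_mul A).sub
      (Real.hasDerivAt_cosh y)).const_mul M).add_const p
  refine strictConvexOn_univ_of_deriv2_pos (by fun_prop) fun y => ?_
  rw [Function.iterate_succ, Function.iterate_one, Function.comp_apply,
    funext fun y => (h1 y).deriv, (h2 y).deriv]
  have := Real.cosh_pos y
  have := Real.sinh_lt_cosh y
  exact mul_pos hM (by nlinarith)

theorem sq_div_four_le_cosh (y : ℝ) : y ^ 2 / 4 ≤ Real.cosh y := by
  have h := Real.quadratic_le_exp_of_nonneg (abs_nonneg y)
  rw [← Real.cosh_abs, Real.cosh_eq]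
  have := Real.exp_pos (-|y|)
  have := abs_nonneg y
  rw [sq_abs] at h
  linarith

theorem exists_zeros_mul_cosh_sub_sinh_add_linear {A M : ℝ} (hA : 1 < A) (hM : 0 < M)
    (p q : ℝ) {m : ℝ} (hm : M * (A * Real.cosh m - Real.sinh m) + p * m + q < 0) :
    ∃ a b, a ≠ b ∧
      {y | M * (A * Real.cosh y - Real.sinh y) + p * y + q = 0} = {a, b} := by
  have hc : 0 < M * (A - 1) / 4 := by
    have := sub_pos.2 hA
    positivity
  obtain ⟨R, hR⟩ := exists_pos_forall_le_abs_quadratic_pos hc p q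
  have hpos (y : ℝ) (hy : R ≤ |y|) :
      0 < M * (A * Real.cosh y - Real.sinh y) + p * y + q := by
    have h1 := hR y hy
    have h2 := sq_div_four_le_cosh y
    have h3 := Real.sinh_lt_cosh y
    have h4 : M * ((A - 1) * (y ^ 2 / 4)) ≤ M * (A * Real.cosh y - Real.sinh y) := by
      gcongr
      nlinarith
    linarith
  have hle : R ≤ |R| := le_abs_self R
  have hm' := abs_nonneg m
  refine (strictConvexOn_mul_cosh_sub_sinh_add_linear hA hM p q).exists_zeros_eq_pair
    (by fun_prop) (u := -(|R| + |m| + 1)) (v := |R| + |m| + 1) (m := m) ?_ ?_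
    (hpos _ ?_) hm (hpos _ ?_)
  · linarith [neg_abs_le m, abs_nonneg R]
  · linarith [le_abs_self m, abs_nonneg R]
  · rw [abs_neg]
    exact le_trans (by linarith) (le_abs_self _)
  · exact le_trans (by linarith) (le_abs_self _)

theorem sinh_pos_and_mul_sinh_eq_cosh {A L : ℝ} (hA : 1 < A)
    (hL : L = (1 / 2) * Real.log ((A + 1) / (A - 1))) :
    0 < Real.sinh L ∧ A * Real.sinh L = Real.cosh L := by
  have h1 : 0 < A - 1 := sub_pos.2 hA
  have h2 : 1 < (A + 1) / (A - 1) := by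
    rw [one_lt_div h1]
    linarith
  have hL0 : 0 < L := by
    have := Real.log_pos h2
    linarith
  have h3 : Real.exp L * Real.exp L = (A + 1) / (A - 1) := by
    rw [← Real.exp_add, show L + L = Real.log ((A + 1) / (A - 1)) by linarith,
      Real.exp_log (by linarith)]
  rw [eq_div_iff h1.ne'] at h3
  have h4 : Real.exp L * Real.exp (-L) = 1 := by
    rw [← Real.exp_add, add_neg_cancel, Real.exp_zero]
  refine ⟨Real.sinh_pos_iff.2 hL0, ?_⟩
  rw [Real.sinh_eq, Real.cosh_eq]
  apply mul_left_cancel₀ (Real.exp_pos L).ne'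
  linear_combination h3 / 2 - (A + 1) / 2 * h4

theorem mul_sinh_sub_cosh_eq_zero_iff {A L : ℝ} (hs : 0 < Real.sinh L)
    (hL : A * Real.sinh L = Real.cosh L) (y : ℝ) :
    A * Real.sinh y - Real.cosh y = 0 ↔ y = L := by
  have h : Real.sinh L * (A * Real.sinh y - Real.cosh y) = Real.sinh (y - L) := by
    rw [Real.sinh_sub]
    linear_combination Real.sinh y * hL
  rw [← mul_eq_zero_iff_left hs.ne', h, Real.sinh_eq_zero, sub_eq_zero]

theorem mul_cosh_sub_sinh_le {A L : ℝ} (hs : 0 < Real.sinh L)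
    (hL : A * Real.sinh L = Real.cosh L) (y : ℝ) :
    A * Real.cosh L - Real.sinh L ≤ A * Real.cosh y - Real.sinh y := by
  have h (y : ℝ) : Real.sinh L * (A * Real.cosh y - Real.sinh y) = Real.cosh (y - L) := by
    rw [Real.cosh_sub]
    linear_combination Real.cosh y * hL
  refine le_of_mul_le_mul_left ?_ hs
  rw [h, h, sub_self, Real.cosh_zero]
  exact Real.one_le_cosh _

theorem sin_eq_zero_iff_of_mem_Icc_neg_pi_pi {x : ℝ} (hx : x ∈ Set.Icc (-Real.pi) Real.pi) :
    Real.sin x = 0 ↔ x = 0 ∨ x = Real.pi ∨ x = -Real.pi := by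
  refine ⟨fun h => ?_, ?_⟩
  · by_contra! hne
    exact hne.1 ((Real.sin_eq_zero_iff_of_lt_of_lt (lt_of_le_of_ne hx.1 hne.2.2.symm)
      (lt_of_le_of_ne hx.2 hne.2.1)).1 h)
  · rintro (rfl | rfl | rfl) <;> simp


/-- for `A > 1`, `γ₁ < 0`, `𝔠 > 0`, with `Ỹ` the unique critical
point of `Y ↦ F(π,Y)` (i.e. `M₁(A sinh Ỹ − cosh Ỹ) = −γ₁`), under the
conditions `F(π,Ỹ) > 0`, `F(0, max(kh₁−ε, L̃)) < 0` and `F(0,−ε) < 0`, the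
system has exactly `6` singular points in `[−π,π] × ℝ`: `F(0,·)` and
`F(±π,·)` have two zeros each, and no singular point lies on the line
`Y = L̃`. -/
theorem stmt18 (A k h₁ 𝔠 γ₁ ε₁ M₁ L ε Yt : ℝ) (hA : 1 < A)
    (hk : 0 < k) (hh₁ : 0 < h₁) (h𝔠 : 0 < 𝔠) (hγ : γ₁ < 0)
    (hε : 0 < ε₁) (hε1 : ε₁ < 1) (hM : M₁ = ε₁ * (k * 𝔠))
    (hL : L = (1 / 2) * Real.log ((A + 1) / (A - 1)))
    (hYt : M₁ * (A * Real.sinh Yt - Real.cosh Yt) = -γ₁)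
    (hYtu : ∀ Y : ℝ, M₁ * (A * Real.sinh Y - Real.cosh Y) = -γ₁ → Y = Yt)
    (hcond1 : 0 < Fup M₁ (k * 𝔠) γ₁ A Real.pi Yt)
    (hcond2 : Fup M₁ (k * 𝔠) γ₁ A 0 (max (k * h₁ - ε) L) < 0)
    (hcond3 : Fup M₁ (k * 𝔠) γ₁ A 0 (-ε) < 0) :
    {p : ℝ × ℝ | p.1 ∈ Set.Icc (-Real.pi) Real.pi ∧
        Fup M₁ (k * 𝔠) γ₁ A p.1 p.2 = 0 ∧ Gup M₁ A p.1 p.2 = 0}.ncard = 6 ∧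
    {Y : ℝ | Fup M₁ (k * 𝔠) γ₁ A 0 Y = 0}.ncard = 2 ∧
    (∀ Y : ℝ, Fup M₁ (k * 𝔠) γ₁ A Real.pi Y
        = Fup M₁ (k * 𝔠) γ₁ A (-Real.pi) Y) ∧
    {Y : ℝ | Fup M₁ (k * 𝔠) γ₁ A Real.pi Y = 0}.ncard = 2 ∧
    (∀ X : ℝ, X ∈ Set.Icc (-Real.pi) Real.pi →
        Fup M₁ (k * 𝔠) γ₁ A X L ≠ 0) := by
  have hν : 0 < k * 𝔠 := mul_pos hk h𝔠
  have hM0 : 0 < M₁ := hM ▸ mul_pos hε hν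
  obtain ⟨hs, hLs⟩ := sinh_pos_and_mul_sinh_eq_cosh hA hL
  have hpi (Y : ℝ) : Fup M₁ (k * 𝔠) γ₁ A Real.pi Y = Fup M₁ (k * 𝔠) γ₁ A (-Real.pi) Y := by
    simp [Fup]
  have hne (X : ℝ) : Fup M₁ (k * 𝔠) γ₁ A X L ≠ 0 := by
    refine ne_of_lt (lt_of_le_of_lt ?_ hcond2)
    have h1 := mul_cosh_sub_sinh_le hs hLs (max (k * h₁ - ε) L)
    have h2 : 0 ≤ A * Real.cosh L - Real.sinh L := by
      nlinarith [Real.cosh_pos L, Real.sinh_lt_cosh L]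
    have h3 : γ₁ * max (k * h₁ - ε) L ≤ γ₁ * L :=
      mul_le_mul_of_nonpos_left (le_max_right _ _) hγ.le
    have h4 : M₁ * Real.cos X * (A * Real.cosh L - Real.sinh L) ≤
        M₁ * 1 * (A * Real.cosh (max (k * h₁ - ε) L) - Real.sinh (max (k * h₁ - ε) L)) := by
      gcongr
      exact Real.cos_le_one X
    simp only [Fup, Real.cos_zero]
    linarith
  obtain ⟨a, b, hab, h0⟩ : ∃ a b, a ≠ b ∧
      {Y : ℝ | Fup M₁ (k * 𝔠) γ₁ A 0 Y = 0} = {a, b} := by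
    have hF (Y : ℝ) : Fup M₁ (k * 𝔠) γ₁ A 0 Y =
        M₁ * (A * Real.cosh Y - Real.sinh Y) + -γ₁ * Y + -(k * 𝔠) := by
      rw [Fup, Real.cos_zero]
      ring
    simp only [hF] at hcond3 ⊢
    exact exists_zeros_mul_cosh_sub_sinh_add_linear hA hM0 _ _ hcond3
  obtain ⟨c, d, hcd, h1⟩ : ∃ c d, c ≠ d ∧
      {Y : ℝ | Fup M₁ (k * 𝔠) γ₁ A Real.pi Y = 0} = {c, d} := by
    have hF (Y : ℝ) : Fup M₁ (k * 𝔠) γ₁ A Real.pi Y =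
        -(M₁ * (A * Real.cosh Y - Real.sinh Y) + γ₁ * Y + k * 𝔠) := by
      rw [Fup, Real.cos_pi]
      ring
    simp only [hF, neg_eq_zero, neg_pos] at hcond1 ⊢
    exact exists_zeros_mul_cosh_sub_sinh_add_linear hA hM0 _ _ hcond1
  refine ⟨?_, by rw [h0, Set.ncard_pair hab], hpi, by rw [h1, Set.ncard_pair hcd],
    fun X _ => hne X⟩
  have h0' (Y : ℝ) : Fup M₁ (k * 𝔠) γ₁ A 0 Y = 0 ↔ Y = a ∨ Y = b := Set.ext_iff.1 h0 Y
  have h1' (Y : ℝ) : Fup M₁ (k * 𝔠) γ₁ A Real.pi Y = 0 ↔ Y = c ∨ Y = d := Set.ext_iff.1 h1 Y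
  have hset : {p : ℝ × ℝ | p.1 ∈ Set.Icc (-Real.pi) Real.pi ∧
      Fup M₁ (k * 𝔠) γ₁ A p.1 p.2 = 0 ∧ Gup M₁ A p.1 p.2 = 0} =
      (({(0, a), (0, b), (Real.pi, c), (Real.pi, d), (-Real.pi, c), (-Real.pi, d)} :
        Finset (ℝ × ℝ)) : Set (ℝ × ℝ)) := by
    ext ⟨X, Y⟩
    simp only [Set.mem_ofPred_eq, Finset.coe_insert, Finset.coe_singleton, Set.mem_insert_iff,
      Set.mem_singleton_iff, Prod.mk.injEq]
    constructor
    · rintro ⟨hX, hF, hG⟩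
      have hsin : Real.sin X = 0 := by
        rw [Gup, mul_eq_zero, mul_eq_zero] at hG
        rcases hG with (h | h) | h
        · exact absurd h hM0.ne'
        · exact h
        · rw [(mul_sinh_sub_cosh_eq_zero_iff hs hLs Y).1 h] at hF
          exact absurd hF (hne X)
      rcases (sin_eq_zero_iff_of_mem_Icc_neg_pi_pi hX).1 hsin with rfl | rfl | rfl
      · have := (h0' Y).1 hF
        tauto
      · have := (h1' Y).1 hF
        tauto
      · have := (h1' Y).1 ((hpi Y).trans hF)
        tauto
    · have hp := Real.pi_pos
      have hmem : (X = 0 ∧ (Y = a ∨ Y = b)) ∨ (X = Real.pi ∧ (Y = c ∨ Y = d)) ∨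
          (X = -Real.pi ∧ (Y = c ∨ Y = d)) → X ∈ Set.Icc (-Real.pi) Real.pi ∧
          Fup M₁ (k * 𝔠) γ₁ A X Y = 0 ∧ Gup M₁ A X Y = 0 := by
        rintro (⟨rfl, hY⟩ | ⟨rfl, hY⟩ | ⟨rfl, hY⟩)
        · exact ⟨⟨by linarith, hp.le⟩, (h0' Y).2 hY, by simp [Gup]⟩
        · exact ⟨⟨by linarith, le_rfl⟩, (h1' Y).2 hY, by simp [Gup]⟩
        · exact ⟨⟨le_rfl, by linarith⟩, (hpi Y).symm.trans ((h1' Y).2 hY), by simp [Gup]⟩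
      exact fun h => hmem (by tauto)
  have hp : Real.pi ≠ 0 := Real.pi_ne_zero
  have hpn : Real.pi ≠ -Real.pi := fun h => by linarith [Real.pi_pos]
  rw [hset, Set.ncard_coe_finset]
  simp [Finset.card_insert_of_notMem, hab, hcd, hp, hp.symm, hpn]
end
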